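/- arXiv:1405.5336 — 8 statements merged into one kernel-verified Lean document; each statement's English description precedes it below -/
import Mathlib

section
/- Let t > 1 and let ρ*(t) be the unique solution in (0,1) of x = 1 − exp(−t·x). Fix any ρ with 0 < ρ < ρ*(t) and set δ = (1 − exp(−t·ρ))/ρ − 1, which is strictly positive. Then for every real K ≥ ρ, (K/ρ)·(1 − (1 − ρ/K)^{tK}) ≥ (1 + δ)·K, where the exponent tK is a real power. -/
/-- Let `t > 1` and let `ρ*` be the unique solution in `(0,1)` of
`x = 1 − exp(−t·x)`. Fix `0 < ρ < ρ*` and set `δ = (1 − exp(−t·ρ))/ρ − 1 > 0`. Then for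
every real `K ≥ ρ`, `(K/ρ)·(1 − (1 − ρ/K)^(t·K)) ≥ (1 + δ)·K` (real power). -/
theorem stmt3 (t ρstar ρ : ℝ) (ht : 1 < t)
    (hρstar : ρstar ∈ Set.Ioo (0 : ℝ) 1)
    (hfix : ρstar = 1 - Real.exp (-t * ρstar))
    (huniq : ∀ x ∈ Set.Ioo (0 : ℝ) 1, x = 1 - Real.exp (-t * x) → x = ρstar)
    (hρ0 : 0 < ρ) (hρ : ρ < ρstar) :
    0 < (1 - Real.exp (-t * ρ)) / ρ - 1 ∧
      ∀ K : ℝ, ρ ≤ K →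
        (1 + ((1 - Real.exp (-t * ρ)) / ρ - 1)) * K ≤
          (K / ρ) * (1 - (1 - ρ / K) ^ (t * K)) := by
  obtain ⟨hpos, -⟩ := hρstar
  have ht0 : 0 < t := by linarith
  refine ⟨?_, fun K hK => ?_⟩
  · have hconv := strictConvexOn_exp.2 (Set.mem_univ 0) (Set.mem_univ (-t * ρstar))
      (by nlinarith [mul_pos ht0 hpos]) (sub_pos.2 ((div_lt_one hpos).2 hρ))
      (div_pos hρ0 hpos) (sub_add_cancel 1 (ρ / ρstar))
    have hexp : Real.exp (-t * ρstar) = 1 - ρstar := by linarith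
    have harg : (1 - ρ / ρstar) • (0 : ℝ) + (ρ / ρstar) • (-t * ρstar) = -t * ρ := by
      simp only [smul_eq_mul]
      field_simp
      ring
    have hval : (1 - ρ / ρstar) • Real.exp 0 + (ρ / ρstar) • Real.exp (-t * ρstar) = 1 - ρ := by
      rw [hexp, Real.exp_zero]
      simp only [smul_eq_mul]
      field_simp
      ring
    rw [harg, hval] at hconv
    rw [sub_pos, one_lt_div hρ0]
    linarith
  · have hK0 : 0 < K := hρ0.trans_le hK
    have hpow : (1 - ρ / K) ^ (t * K) ≤ Real.exp (-t * ρ) :=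
      calc (1 - ρ / K) ^ (t * K) ≤ Real.exp (-(ρ / K)) ^ (t * K) :=
            Real.rpow_le_rpow (sub_nonneg.2 ((div_le_one hK0).2 hK))
              (Real.one_sub_le_exp_neg _) (by positivity)
        _ = Real.exp (-t * ρ) := by
            rw [← Real.exp_mul]
            congr 1
            field_simp
    calc (1 + ((1 - Real.exp (-t * ρ)) / ρ - 1)) * K
        = (K / ρ) * (1 - Real.exp (-t * ρ)) := by ring
      _ ≤ (K / ρ) * (1 - (1 - ρ / K) ^ (t * K)) := by gcongr
end

section
/- Fix t > 1 and ε ∈ (0,1), and set ρ = (1−ε)·ρ*(t), where ρ*(t) is the unique solution in (0,1) of x = 1 − exp(−t·x). For each positive integer K, let X_1, …, X_{⌈tK⌉} be independent random variables, each uniformly distributed on a finite set of ⌈K/ρ⌉ elements, and let Z_K be the number of distinct values taken by X_1, …, X_{⌈tK⌉}. Then P(Z_K ≥ K) → 1 as K → ∞. -/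
open Filter

/-- The number of elements of `β` that `f` misses. -/
def missCard {α β : Type*} [Fintype α] [Fintype β] [DecidableEq β] (f : α → β) : ℕ :=
  (Finset.univ.filter (fun j => ∀ i, f i ≠ j)).card

section Counting

variable {α β : Type*} [Fintype α] [Fintype β] [DecidableEq β]

lemma missCard_add_card_image (f : α → β) :
    missCard f + (Finset.image f Finset.univ).card = Fintype.card β := by
  have h : Finset.univ.filter (fun j => ∀ i, f i ≠ j) = (Finset.image f Finset.univ)ᶜ := by
    ext j
    simp
  rw [missCard, h, Finset.card_compl_add_card]

lemma cast_missCard (f : α → β) :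
    (missCard f : ℝ) = ∑ j, if ∀ i, f i ≠ j then (1 : ℝ) else 0 := by
  simp [missCard]

variable [DecidableEq α]

lemma card_forall_mem (S : Finset β) :
    (Finset.univ.filter (fun f : α → β => ∀ i, f i ∈ S)).card = S.card ^ Fintype.card α := by
  have h : Finset.univ.filter (fun f : α → β => ∀ i, f i ∈ S) =
      Fintype.piFinset (fun _ => S) := by
    ext f
    simp
  simp [h]

lemma card_forall_ne (j : β) :
    (Finset.univ.filter (fun f : α → β => ∀ i, f i ≠ j)).card =
      (Fintype.card β - 1) ^ Fintype.card α := by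
  simpa [Finset.card_compl] using card_forall_mem (α := α) ({j}ᶜ : Finset β)

lemma card_forall_ne_and_ne {j k : β} (hjk : j ≠ k) :
    (Finset.univ.filter (fun f : α → β => (∀ i, f i ≠ j) ∧ ∀ i, f i ≠ k)).card =
      (Fintype.card β - 2) ^ Fintype.card α := by
  have h := card_forall_mem (α := α) ({j, k}ᶜ : Finset β)
  rw [Finset.card_compl, Finset.card_pair hjk] at h
  rw [← h]
  congr 1
  ext f
  simp [forall_and]

lemma sum_missCard :
    ∑ f : α → β, (missCard f : ℝ) =
      Fintype.card β * ((Fintype.card β - 1 : ℕ) : ℝ) ^ Fintype.card α := by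
  simp_rw [cast_missCard]
  rw [Finset.sum_comm]
  simp_rw [Finset.sum_boole, card_forall_ne]
  simp

lemma sum_missCard_sq_le :
    ∑ f : α → β, (missCard f : ℝ) ^ 2 ≤
      Fintype.card β * ((Fintype.card β - 1 : ℕ) : ℝ) ^ Fintype.card α +
        (Fintype.card β : ℝ) ^ 2 * ((Fintype.card β - 2 : ℕ) : ℝ) ^ Fintype.card α := by
  have h1 : ∑ f : α → β, (missCard f : ℝ) ^ 2 =
      ∑ j : β, ∑ k : β, ((Finset.univ.filter
        (fun f : α → β => (∀ i, f i ≠ j) ∧ ∀ i, f i ≠ k)).card : ℝ) := by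
    simp_rw [cast_missCard, sq, Finset.sum_mul_sum, ← Finset.sum_boole]
    rw [Finset.sum_comm]
    refine Finset.sum_congr rfl fun j _ => ?_
    rw [Finset.sum_comm]
    refine Finset.sum_congr rfl fun k _ => Finset.sum_congr rfl fun f _ => ?_
    rw [ite_and]
    split_ifs <;> simp
  have h2 : ∀ j k : β, ((Finset.univ.filter
        (fun f : α → β => (∀ i, f i ≠ j) ∧ ∀ i, f i ≠ k)).card : ℝ) ≤
      (if j = k then ((Fintype.card β - 1 : ℕ) : ℝ) ^ Fintype.card α else 0) +
        ((Fintype.card β - 2 : ℕ) : ℝ) ^ Fintype.card α := by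
    intro j k
    split_ifs with hjk
    · subst hjk
      simp_rw [and_self, card_forall_ne]
      push_cast
      exact le_add_of_nonneg_right (by positivity)
    · rw [card_forall_ne_and_ne hjk]
      simp
  rw [h1]
  refine (Finset.sum_le_sum fun j _ => Finset.sum_le_sum fun k _ => h2 j k).trans_eq ?_
  simp [Finset.sum_add_distrib]
  ring

/-- The variance of the number of missed elements is at most the number of elements. -/
lemma sum_missCard_sub_sq_le [Nonempty β] :
    ∑ f : α → β,
        ((missCard f : ℝ) -
          Fintype.card β * (1 - 1 / (Fintype.card β : ℝ)) ^ Fintype.card α) ^ 2 ≤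
      Fintype.card β * (Fintype.card β : ℝ) ^ Fintype.card α := by
  have hn : 1 ≤ Fintype.card β := Fintype.card_pos
  have hA := sum_missCard (α := α) (β := β)
  have hB := sum_missCard_sq_le (α := α) (β := β)
  have hcard : ((Finset.univ : Finset (α → β)).card : ℝ) =
      (Fintype.card β : ℝ) ^ Fintype.card α := by simp
  generalize Fintype.card β = n at *
  generalize Fintype.card α = m at *
  have hn' : (1 : ℝ) ≤ n := by exact_mod_cast hn
  have hn0 : (0 : ℝ) < n := by linarith
  have hp0 : 0 ≤ 1 - 1 / (n : ℝ) := by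
    rw [sub_nonneg, div_le_one hn0]
    exact hn'
  have hp1 : 1 - 1 / (n : ℝ) ≤ 1 := by
    have : 0 < 1 / (n : ℝ) := by positivity
    linarith
  have e1 : ((n - 1 : ℕ) : ℝ) = n * (1 - 1 / (n : ℝ)) := by
    rw [Nat.cast_sub hn]
    field_simp
    simp
  have e2 : ((n - 2 : ℕ) : ℝ) ≤ n * (1 - 1 / (n : ℝ)) ^ 2 := by
    have h : (n : ℝ) * (1 - 1 / (n : ℝ)) ^ 2 = n - 2 + 1 / n := by
      field_simp
      ring
    have h' : 0 < 1 / (n : ℝ) := by positivity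
    rcases le_total 2 n with h2 | h2
    · rw [h, Nat.cast_sub h2]
      push_cast
      linarith
    · rw [Nat.sub_eq_zero_of_le h2]
      simpa using by positivity
  have e3 : ((n - 2 : ℕ) : ℝ) ^ m ≤ (n * (1 - 1 / (n : ℝ)) ^ 2) ^ m :=
    pow_le_pow_left₀ (Nat.cast_nonneg _) e2 m
  have hq1 : (1 - 1 / (n : ℝ)) ^ m ≤ 1 := pow_le_one₀ hp0 hp1
  rw [e1, mul_pow] at hA hB
  rw [mul_pow, pow_right_comm] at e3
  generalize (1 - 1 / (n : ℝ)) ^ m = q at *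
  have hexp : ∑ f : α → β, ((missCard f : ℝ) - n * q) ^ 2 =
      ∑ f : α → β, (missCard f : ℝ) ^ 2 - 2 * (n * q) * ∑ f : α → β, (missCard f : ℝ) +
        (n : ℝ) ^ m * (n * q) ^ 2 := by
    simp_rw [sub_sq, Finset.sum_add_distrib, Finset.sum_sub_distrib, Finset.mul_sum,
      Finset.sum_const, nsmul_eq_mul, hcard]
    congr 2
    exact Finset.sum_congr rfl fun f _ => by ring
  rw [hexp, hA]
  have hN : (0 : ℝ) ≤ n * (n : ℝ) ^ m := by positivity
  have e4 := mul_le_mul_of_nonneg_left e3 (sq_nonneg (n : ℝ))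
  have e5 := mul_le_mul_of_nonneg_left hq1 hN
  linarith

/-- Chebyshev's inequality for the size of the image of a uniformly random function. -/
lemma one_sub_le_card_image_ge_div [Nonempty β] {K : ℕ} {d : ℝ} (hd : 0 < d)
    (hK : d ≤ Fintype.card β - K -
      Fintype.card β * (1 - 1 / (Fintype.card β : ℝ)) ^ Fintype.card α) :
    1 - Fintype.card β / d ^ 2 ≤
      ((Finset.univ.filter
        (fun f : α → β => K ≤ (Finset.image f Finset.univ).card)).card : ℝ) /
          ((Finset.univ : Finset (α → β)).card : ℝ) := by
  have hV := sum_missCard_sub_sq_le (α := α) (β := β)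
  have hcard : ((Finset.univ : Finset (α → β)).card : ℝ) =
      (Fintype.card β : ℝ) ^ Fintype.card α := by simp
  have hpos : (0 : ℝ) < (Fintype.card β : ℝ) ^ Fintype.card α := by
    have : 0 < Fintype.card β := Fintype.card_pos
    positivity
  have hsplit := Finset.card_filter_add_card_filter_not (s := (Finset.univ : Finset (α → β)))
    (fun f : α → β => K ≤ (Finset.image f Finset.univ).card)
  have hbad : ((Finset.univ.filter
      (fun f : α → β => ¬ K ≤ (Finset.image f Finset.univ).card)).card : ℝ) * d ^ 2 ≤
      Fintype.card β * (Fintype.card β : ℝ) ^ Fintype.card α := by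
    refine le_trans ?_ hV
    rw [← nsmul_eq_mul]
    refine (Finset.card_nsmul_le_sum _ _ _ fun f hf => ?_).trans
      (Finset.sum_le_sum_of_subset_of_nonneg (Finset.filter_subset _ _)
        fun f _ _ => sq_nonneg _)
    have hlt : (Finset.image f Finset.univ).card < K := by simpa using hf
    have hlt' : ((Finset.image f Finset.univ).card : ℝ) < K := by exact_mod_cast hlt
    have hadd : (missCard f : ℝ) + (Finset.image f Finset.univ).card = Fintype.card β := by
      exact_mod_cast missCard_add_card_image f
    exact pow_le_pow_left₀ hd.le (by linarith) 2
  have hsplit' := congrArg (Nat.cast (R := ℝ)) hsplit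
  rw [Nat.cast_add, hcard] at hsplit'
  rw [hcard, le_div_iff₀ hpos, sub_mul, one_mul, div_mul_eq_mul_div]
  have := (le_div_iff₀ (by positivity : 0 < d ^ 2)).2 hbad
  linarith

end Counting

/-- Below the positive fixed point of `x ↦ 1 - exp (-t * x)`, the map lies above the diagonal. -/
lemma lt_one_sub_exp_of_fixedPoint {t r : ℝ} (ht : t ≠ 0) (hr : 0 < r)
    (hfix : r = 1 - Real.exp (-t * r)) {ε : ℝ} (hε : ε ∈ Set.Ioo (0 : ℝ) 1) :
    (1 - ε) * r < 1 - Real.exp (-t * ((1 - ε) * r)) := by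
  have h := strictConvexOn_exp.2 (Set.mem_univ (0 : ℝ)) (Set.mem_univ (-t * r))
    (by simp [ht, hr.ne']) hε.1 (sub_pos.2 hε.2) (by ring)
  simp only [smul_eq_mul, mul_zero, zero_add, Real.exp_zero, mul_one] at h
  have e : (1 - ε) * (-t * r) = -t * ((1 - ε) * r) := by ring
  rw [e] at h
  have : Real.exp (-t * r) = 1 - r := by linarith
  rw [this] at h
  linarith

theorem stmt4 (t ε : ℝ) (ht : 1 < t) (hε : ε ∈ Set.Ioo (0 : ℝ) 1)
    (ρstar : ℝ) (hρstar : ρstar ∈ Set.Ioo (0 : ℝ) 1)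
    (hfix : ρstar = 1 - Real.exp (-t * ρstar))
    (ρ : ℝ) (hρ : ρ = (1 - ε) * ρstar) :
    Tendsto (fun K : ℕ =>
        (((Finset.univ : Finset (Fin ⌈t * K⌉₊ → Fin ⌈(K : ℝ) / ρ⌉₊)).filter
            (fun f => K ≤ (Finset.image f Finset.univ).card)).card : ℝ) /
          ((Finset.univ : Finset (Fin ⌈t * K⌉₊ → Fin ⌈(K : ℝ) / ρ⌉₊)).card : ℝ))
      atTop (nhds 1) := by
  have hρ0 : 0 < ρ := hρ ▸ mul_pos (sub_pos.2 hε.2) hρstar.1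
  have hgap : ρ < 1 - Real.exp (-t * ρ) := by
    rw [hρ]
    exact lt_one_sub_exp_of_fixedPoint (by linarith) hρstar.1 hfix hε
  have hn : Tendsto (fun K : ℕ => (⌈(K : ℝ) / ρ⌉₊ : ℝ) / K) atTop (nhds ρ⁻¹) := by
    have := (tendsto_nat_ceil_mul_div_atTop (R := ℝ) (inv_nonneg.2 hρ0.le)).comp
      tendsto_natCast_atTop_atTop
    refine this.congr fun K => ?_
    simp only [Function.comp, div_eq_inv_mul (K : ℝ) ρ]
  have hD : Tendsto (fun K : ℕ => (⌈(K : ℝ) / ρ⌉₊ : ℝ) / K - 1 -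
      (⌈(K : ℝ) / ρ⌉₊ : ℝ) / K * Real.exp (-t * ((⌈(K : ℝ) / ρ⌉₊ : ℝ) / K)⁻¹))
      atTop (nhds (ρ⁻¹ - 1 - ρ⁻¹ * Real.exp (-t * ρ))) := by
    have hinv := hn.inv₀ (inv_ne_zero hρ0.ne')
    rw [inv_inv] at hinv
    exact (hn.sub_const 1).sub
      (hn.mul ((Real.continuous_exp.tendsto _).comp (hinv.const_mul (-t))))
  have hc : 0 < ρ⁻¹ - 1 - ρ⁻¹ * Real.exp (-t * ρ) := by
    have : ρ⁻¹ - 1 - ρ⁻¹ * Real.exp (-t * ρ) = ρ⁻¹ * (1 - Real.exp (-t * ρ) - ρ) := by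
      field_simp
      ring
    rw [this]
    exact mul_pos (inv_pos.2 hρ0) (by linarith)
  have hlow := ((hn.div (hD.pow 2) (pow_pos hc 2).ne').mul
    (tendsto_inv_atTop_nhds_zero_nat (𝕜 := ℝ))).const_sub 1
  simp only [mul_zero, sub_zero, Pi.div_apply] at hlow
  refine tendsto_of_tendsto_of_tendsto_of_le_of_le' hlow tendsto_const_nhds ?_ ?_
  · filter_upwards [hD.eventually (lt_mem_nhds hc), eventually_gt_atTop 0] with K hK hK0
    have hK0' : (0 : ℝ) < K := by exact_mod_cast hK0
    have hn0 : 0 < ⌈(K : ℝ) / ρ⌉₊ := Nat.ceil_pos.2 (by positivity)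
    have hm := Nat.le_ceil (t * (K : ℝ))
    generalize ⌈(K : ℝ) / ρ⌉₊ = n at *
    generalize ⌈t * (K : ℝ)⌉₊ = m at *
    have hn0' : (0 : ℝ) < n := by exact_mod_cast hn0
    have hn1 : (1 : ℝ) ≤ n := by exact_mod_cast hn0
    have : Nonempty (Fin n) := ⟨⟨0, hn0⟩⟩
    have hmiss : (1 - 1 / (n : ℝ)) ^ m ≤ Real.exp (-t * ((n : ℝ) / K)⁻¹) := by
      calc (1 - 1 / (n : ℝ)) ^ m ≤ Real.exp (-(1 / (n : ℝ))) ^ m :=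
            pow_le_pow_left₀ (by rw [sub_nonneg, div_le_one hn0']; exact hn1)
              (Real.one_sub_le_exp_neg _) m
        _ = Real.exp (-(m / (n : ℝ))) := by
            rw [← Real.exp_nat_mul]
            congr 1
            ring
        _ ≤ _ := by
            rw [Real.exp_le_exp, inv_div, neg_mul, neg_le_neg_iff, ← mul_div_assoc]
            gcongr
    set d := (n : ℝ) / K - 1 - (n : ℝ) / K * Real.exp (-t * ((n : ℝ) / K)⁻¹) with hd
    have hKd : K * d = n - K - n * Real.exp (-t * ((n : ℝ) / K)⁻¹) := by
      rw [hd, mul_sub, mul_sub, ← mul_assoc, mul_div_cancel₀ _ hK0'.ne', mul_one]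
    have key := one_sub_le_card_image_ge_div (α := Fin m) (β := Fin n) (K := K)
      (mul_pos hK0' hK) (by
        rw [hKd]
        simp only [Fintype.card_fin]
        gcongr)
    refine le_trans (le_of_eq ?_) key
    rw [Fintype.card_fin]
    field_simp
  · refine Eventually.of_forall fun K => div_le_one_of_le₀ ?_ (Nat.cast_nonneg _)
    exact_mod_cast Finset.card_filter_le _ _
end

section
/- For every integer n ≥ 2 and every real p with 0 < p < 1: Σ_{s=2}^{n} (s/(s−1))·C(n,s)·p^{s−1}·(1−p)^{n−s+1} ≤ ((1−p)/p)·[ 1 + (3/((n+1)·p))·(1 − (1−p)^{n+1}) − 4·(1−p)^n − (5/2)·n·p·(1−p)^{n−1} ]. -/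
open Finset in
/-- The binomial distribution sums to one. -/
theorem sum_choose_mul_pow_mul_one_sub_pow (n : ℕ) (p : ℝ) :
    ∑ s ∈ range (n + 1), (n.choose s : ℝ) * p ^ s * (1 - p) ^ (n - s) = 1 := by
  have h := add_pow p (1 - p) n
  rw [add_sub_cancel, one_pow] at h
  exact (sum_congr rfl fun s _ => by ring).trans h.symm

open Finset in
/-- The expectation of `1 / (X + 1)` for a binomial random variable `X`. -/
theorem sum_choose_mul_pow_mul_one_sub_pow_div (n : ℕ) {p : ℝ} (hp : p ≠ 0) :
    ∑ s ∈ range (n + 1), (n.choose s : ℝ) * p ^ s * (1 - p) ^ (n - s) / ((s : ℝ) + 1) =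
      (1 - (1 - p) ^ (n + 1)) / (((n : ℝ) + 1) * p) := by
  have hn : (n : ℝ) + 1 ≠ 0 := by positivity
  have h := sum_choose_mul_pow_mul_one_sub_pow (n + 1) p
  rw [sum_range_succ'] at h
  simp only [Nat.choose_zero_right, Nat.cast_one, pow_zero, Nat.sub_zero, one_mul,
    Nat.add_sub_add_right] at h
  rw [eq_div_iff (mul_ne_zero hn hp), ← eq_sub_of_add_eq h, sum_mul]
  refine sum_congr rfl fun s _ => ?_
  have hs : (s : ℝ) + 1 ≠ 0 := by positivity
  have hc : ((n : ℝ) + 1) * n.choose s = (n + 1).choose (s + 1) * ((s : ℝ) + 1) := by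
    exact_mod_cast Nat.add_one_mul_choose_eq n s
  rw [div_mul_eq_mul_div, div_eq_iff hs]
  linear_combination p ^ (s + 1) * (1 - p) ^ (n - s) * hc

open Finset in
/-- Removing the terms `s = 0, 1` from a sum over `0 ≤ s ≤ n`. -/
theorem sum_Icc_two_eq_sum_range_sub {n : ℕ} (hn : 2 ≤ n) (f : ℕ → ℝ) :
    ∑ s ∈ Icc 2 n, f s = ∑ s ∈ range (n + 1), f s - f 0 - f 1 := by
  rw [← Ico_add_one_right_eq_Icc, sum_Ico_eq_sub f (by omega : 2 ≤ n + 1), sum_range_succ f 1,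
    sum_range_one, sub_sub]

theorem div_sub_one_le_one_add_three_div {x : ℝ} (hx : 2 ≤ x) :
    x / (x - 1) ≤ 1 + 3 / (x + 1) := by
  have h : 0 < x - 1 := by linarith
  have h' : 0 < x + 1 := by linarith
  rw [div_le_iff₀ h, ← sub_nonneg]
  have : (1 + 3 / (x + 1)) * (x - 1) - x = (2 * (x - 2)) / (x + 1) := by
    field_simp
    ring
  rw [this]
  exact div_nonneg (by linarith) h'.le

/-- For every integer `n ≥ 2` and real `0 < p < 1`:
`∑_{s=2}^{n} (s/(s−1))·C(n,s)·p^{s−1}·(1−p)^{n−s+1}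
  ≤ ((1−p)/p)·[1 + (3/((n+1)·p))·(1 − (1−p)^{n+1}) − 4·(1−p)^n − (5/2)·n·p·(1−p)^{n−1}]`. -/
theorem stmt9 (n : ℕ) (hn : 2 ≤ n) (p : ℝ) (hp0 : 0 < p) (hp1 : p < 1) :
    ∑ s ∈ Finset.Icc 2 n,
        ((s : ℝ) / ((s : ℝ) - 1)) * (n.choose s : ℝ) * p ^ (s - 1) * (1 - p) ^ (n - s + 1)
      ≤ ((1 - p) / p) *
          (1 + (3 / (((n : ℝ) + 1) * p)) * (1 - (1 - p) ^ (n + 1))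
            - 4 * (1 - p) ^ n - (5 / 2) * (n : ℝ) * p * (1 - p) ^ (n - 1)) := by
  have hq : 0 < 1 - p := sub_pos.2 hp1
  set b : ℕ → ℝ := fun s => (n.choose s : ℝ) * p ^ s * (1 - p) ^ (n - s) with hb
  have hsum : ∑ s ∈ Finset.Icc 2 n, (b s + 3 * (b s / ((s : ℝ) + 1))) =
      1 + (3 / (((n : ℝ) + 1) * p)) * (1 - (1 - p) ^ (n + 1))
        - 4 * (1 - p) ^ n - (5 / 2) * (n : ℝ) * p * (1 - p) ^ (n - 1) := by
    rw [sum_Icc_two_eq_sum_range_sub hn, Finset.sum_add_distrib, ← Finset.mul_sum,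
      sum_choose_mul_pow_mul_one_sub_pow, sum_choose_mul_pow_mul_one_sub_pow_div n hp0.ne']
    simp only [hb, Nat.choose_zero_right, Nat.choose_one_right, Nat.cast_zero, Nat.cast_one,
      pow_zero, pow_one, Nat.sub_zero]
    ring
  rw [← hsum, Finset.mul_sum]
  refine Finset.sum_le_sum fun s hs => ?_
  have hs2 : 2 ≤ s := (Finset.mem_Icc.1 hs).1
  have hpow : p ^ s = p ^ (s - 1) * p := (pow_sub_one_mul (by omega) p).symm
  have hbs : 0 ≤ (1 - p) / p * b s := by positivity
  calc ((s : ℝ) / ((s : ℝ) - 1)) * (n.choose s : ℝ) * p ^ (s - 1) * (1 - p) ^ (n - s + 1)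
      = (s : ℝ) / ((s : ℝ) - 1) * ((1 - p) / p * b s) := by
        simp only [hb, hpow, pow_succ (1 - p)]
        field_simp
    _ ≤ (1 + 3 / ((s : ℝ) + 1)) * ((1 - p) / p * b s) :=
        mul_le_mul_of_nonneg_right (div_sub_one_le_one_add_three_div (by exact_mod_cast hs2)) hbs
    _ = (1 - p) / p * (b s + 3 * (b s / ((s : ℝ) + 1))) := by ring
end

section
/- Let r > 0 and Δ > 0, let o ∈ ℝ², and let (x_1, y_1), …, (x_N, y_N) be pairs of points in the Euclidean plane ℝ² such that: dist(y_i, o) ≤ r for every i; dist(x_i, y_i) ≤ r for every i; and dist(x_j, y_i) ≥ (1+Δ)·r for all i ≠ j. Then N ≤ 4·(2+Δ)²/Δ². -/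
open MeasureTheory in
/-- Volume packing bound: finitely many points of a ball of radius `R` that are pairwise at
distance at least `2 * δ` number at most `((R + δ) / δ) ^ d` in dimension `d`. -/
theorem card_mul_pow_finrank_le_of_separated {E ι : Type*} [NormedAddCommGroup E]
    [NormedSpace ℝ E] [FiniteDimensional ℝ E] [Fintype ι] {R δ : ℝ} (hR : 0 ≤ R) (hδ : 0 < δ)
    (o : E) (y : ι → E) (hyo : ∀ i, dist (y i) o ≤ R)
    (hsep : Pairwise fun i j => 2 * δ ≤ dist (y i) (y j)) :
    (Fintype.card ι : ℝ) * δ ^ Module.finrank ℝ E ≤ (R + δ) ^ Module.finrank ℝ E := by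
  borelize E
  let μ : Measure E := Measure.addHaar
  have hdisj : Pairwise (Function.onFun Disjoint fun i => Metric.ball (y i) δ) := fun i j hij =>
    Metric.ball_disjoint_ball (by linarith [hsep hij])
  have hsub : (⋃ i, Metric.ball (y i) δ) ⊆ Metric.ball o (R + δ) :=
    Set.iUnion_subset fun i => Metric.ball_subset_ball' (by linarith [hyo i])
  have hle := measure_mono (μ := μ) hsub
  rw [measure_iUnion hdisj fun i => measurableSet_ball, tsum_fintype] at hle
  simp only [Measure.addHaar_ball_of_pos μ _ hδ,
    Measure.addHaar_ball_of_pos μ o (by linarith : 0 < R + δ), Finset.sum_const,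
    Finset.card_univ, nsmul_eq_mul, ← mul_assoc] at hle
  rw [ENNReal.mul_le_mul_iff_left (Metric.measure_ball_pos μ _ one_pos).ne'
    measure_ball_lt_top.ne, ← ENNReal.ofReal_natCast,
    ← ENNReal.ofReal_mul (Nat.cast_nonneg _)] at hle
  exact (ENNReal.ofReal_le_ofReal_iff (by positivity)).1 hle


/-- Protocol-model packing bound. Let `r, Δ > 0`, `o ∈ ℝ²`, and let
`(x i, y i)`, `i = 1, …, N`, be transmitter/receiver pairs in the Euclidean plane with
`dist (y i) o ≤ r`, `dist (x i) (y i) ≤ r`, and `dist (x j) (y i) ≥ (1+Δ)·r` for `i ≠ j`.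
Then `N ≤ 4·(2+Δ)²/Δ²`. -/
theorem stmt10 (r Δ : ℝ) (hr : 0 < r) (hΔ : 0 < Δ)
    (o : EuclideanSpace ℝ (Fin 2)) (N : ℕ)
    (x y : Fin N → EuclideanSpace ℝ (Fin 2))
    (hyo : ∀ i, dist (y i) o ≤ r)
    (hxy : ∀ i, dist (x i) (y i) ≤ r)
    (hsep : ∀ i j, i ≠ j → (1 + Δ) * r ≤ dist (x j) (y i)) :
    (N : ℝ) ≤ 4 * (2 + Δ) ^ 2 / Δ ^ 2 := by
  have hy : Pairwise fun i j => 2 * (Δ * r / 2) ≤ dist (y i) (y j) := by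
    intro i j hij
    have htri := dist_triangle (x j) (y j) (y i)
    rw [dist_comm (y j)] at htri
    linarith [hsep i j hij, hxy j]
  have hcard := card_mul_pow_finrank_le_of_separated hr.le (by positivity) o y hyo hy
  rw [finrank_euclideanSpace_fin, Fintype.card_fin] at hcard
  have hmul : (N : ℝ) * Δ ^ 2 * r ^ 2 ≤ (2 + Δ) ^ 2 * r ^ 2 := by linarith
  have hN := le_of_mul_le_mul_right hmul (by positivity)
  rw [le_div_iff₀ (by positivity)]
  linarith [sq_nonneg (2 + Δ)]
end

section
/- Let (m_k) be a sequence of positive integers with m_k → ∞, and let (M_k) be positive reals such that 2·M_k is a positive integer for every k and M_k/m_k → 0. Put ℓ_k = ⌊m_k/(2·M_k)⌋. Then liminf_{k→∞} ( ℓ_k − (ℓ_k/⌊m_k/ℓ_k⌋)·M_k ) · (4·M_k/m_k) ≥ 1. -/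
open Filter

/-- If `j` is a positive natural number and `ℓ = ⌊a / j⌋`, then `⌊a / ℓ⌋ ≥ j`, so that
`ℓ / ⌊a / ℓ⌋ * j ≤ ℓ`. -/
lemma floor_div_div_floor_mul_le {a : ℝ} (ha : 0 ≤ a) {j : ℕ} (hj : 0 < j) :
    (⌊a / j⌋₊ : ℝ) / (⌊a / (⌊a / j⌋₊ : ℝ)⌋₊ : ℝ) * j ≤ ⌊a / j⌋₊ := by
  have hj' : (0 : ℝ) < j := by exact_mod_cast hj
  have hfloor : (⌊a / j⌋₊ : ℝ) ≤ a / j := Nat.floor_le (by positivity)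
  generalize ⌊a / j⌋₊ = l at hfloor ⊢
  rcases l.eq_zero_or_pos with rfl | hl
  · simp
  have hl' : (0 : ℝ) < l := by exact_mod_cast hl
  have hle : j ≤ ⌊a / (l : ℝ)⌋₊ := by
    refine Nat.le_floor ?_
    rw [le_div_iff₀ hj'] at hfloor
    rw [le_div_iff₀ hl']
    linarith
  have hle' : (j : ℝ) ≤ (⌊a / (l : ℝ)⌋₊ : ℝ) := by exact_mod_cast hle
  rw [div_mul_eq_mul_div, div_le_iff₀ (hj'.trans_le hle')]
  gcongr

/-- Let `(m_k)` be positive integers with `m_k → ∞` and `(M_k)` positive reals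
with `2·M_k` a positive integer for every `k` and `M_k/m_k → 0`. Put `ℓ_k = ⌊m_k/(2·M_k)⌋`.
Then `liminf_k (ℓ_k − (ℓ_k/⌊m_k/ℓ_k⌋)·M_k)·(4·M_k/m_k) ≥ 1`. -/
theorem stmt13 (m : ℕ → ℕ) (M : ℕ → ℝ)
    (hm : ∀ k, 0 < m k)
    (hm_top : Tendsto (fun k => (m k : ℝ)) atTop atTop)
    (hM : ∀ k, 0 < M k)
    (hMint : ∀ k, ∃ j : ℕ, 0 < j ∧ 2 * M k = (j : ℝ))
    (hratio : Tendsto (fun k => M k / (m k : ℝ)) atTop (nhds 0)) :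
    1 ≤ atTop.liminf (fun k =>
      ((⌊(m k : ℝ) / (2 * M k)⌋₊ : ℝ)
          - ((⌊(m k : ℝ) / (2 * M k)⌋₊ : ℝ)
              / (⌊(m k : ℝ) / (⌊(m k : ℝ) / (2 * M k)⌋₊ : ℝ)⌋₊ : ℝ)) * M k)
        * (4 * M k / (m k : ℝ))) := by
  have hlower : ∀ k, 1 - 2 * (M k / (m k : ℝ)) ≤
      ((⌊(m k : ℝ) / (2 * M k)⌋₊ : ℝ)
          - ((⌊(m k : ℝ) / (2 * M k)⌋₊ : ℝ)
              / (⌊(m k : ℝ) / (⌊(m k : ℝ) / (2 * M k)⌋₊ : ℝ)⌋₊ : ℝ)) * M k)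
        * (4 * M k / (m k : ℝ)) := by
    intro k
    have hmk : (0 : ℝ) < m k := by exact_mod_cast hm k
    have hMk := hM k
    obtain ⟨j, hj, hMj⟩ := hMint k
    have hcut := floor_div_div_floor_mul_le hmk.le hj
    rw [← hMj] at hcut
    have hlt := Nat.lt_floor_add_one ((m k : ℝ) / (2 * M k))
    calc 1 - 2 * (M k / (m k : ℝ))
        = (((m k : ℝ) / (2 * M k) - 1) / 2) * (4 * M k / (m k : ℝ)) := by
          field_simp
          ring
      _ ≤ _ := by
          gcongr
          linarith
  have hupper : ∀ k,
      ((⌊(m k : ℝ) / (2 * M k)⌋₊ : ℝ)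
          - ((⌊(m k : ℝ) / (2 * M k)⌋₊ : ℝ)
              / (⌊(m k : ℝ) / (⌊(m k : ℝ) / (2 * M k)⌋₊ : ℝ)⌋₊ : ℝ)) * M k)
        * (4 * M k / (m k : ℝ)) ≤ 2 := by
    intro k
    have hmk : (0 : ℝ) < m k := by exact_mod_cast hm k
    have hMk := hM k
    calc _ ≤ ((m k : ℝ) / (2 * M k)) * (4 * M k / (m k : ℝ)) := by
          gcongr
          refine (sub_le_self _ (by positivity)).trans (Nat.floor_le (by positivity))
      _ = 2 := by
          field_simp
          norm_num
  have hlim : Tendsto (fun k => 1 - 2 * (M k / (m k : ℝ))) atTop (nhds 1) := by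
    simpa using (hratio.const_mul 2).const_sub 1
  rw [← hlim.liminf_eq]
  exact liminf_le_liminf (Eventually.of_forall hlower) hlim.isBoundedUnder_ge
    (isBoundedUnder_of ⟨2, hupper⟩ : IsBoundedUnder (· ≤ ·) atTop _).isCoboundedUnder_ge
end

section
/- Let (m_k) be a sequence of positive integers with m_k → ∞, and let (M_k) be positive reals such that 2·M_k is a positive integer for every k and M_k/m_k → 0. Put ℓ_k = ⌊m_k/(2·M_k)⌋. Then limsup_{k→∞} ( (m_k/M_k − 1) / ( ℓ_k − (ℓ_k/⌊m_k/ℓ_k⌋)·M_k ) ) ≤ 4. -/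
open Filter

/-- If `2 * M` is a positive integer and `ℓ = ⌊a / (2 * M)⌋₊` is positive, then `⌊a / ℓ⌋₊ ≥ 2 * M`,
so the cut-set expression at `ℓ` is at least `ℓ / 2`. -/
lemma half_floor_le_cutset {a M : ℝ} (hM : 0 < M) (hMint : ∃ j : ℕ, 0 < j ∧ 2 * M = (j : ℝ))
    (hl : 0 < ⌊a / (2 * M)⌋₊) :
    (⌊a / (2 * M)⌋₊ : ℝ) / 2 ≤ (⌊a / (2 * M)⌋₊ : ℝ)
      - ((⌊a / (2 * M)⌋₊ : ℝ) / (⌊a / (⌊a / (2 * M)⌋₊ : ℝ)⌋₊ : ℝ)) * M := by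
  obtain ⟨j, -, hj⟩ := hMint
  have hx : (⌊a / (2 * M)⌋₊ : ℝ) ≤ a / (2 * M) := Nat.floor_le (Nat.pos_of_floor_pos hl).le
  generalize ⌊a / (2 * M)⌋₊ = l at hl hx ⊢
  have hl' : (0 : ℝ) < l := by exact_mod_cast hl
  have hq : 2 * M ≤ (⌊a / (l : ℝ)⌋₊ : ℝ) := by
    rw [le_div_iff₀ (by positivity)] at hx
    rw [hj, Nat.cast_le]
    apply Nat.le_floor
    rw [← hj, le_div_iff₀ hl']
    linarith
  generalize (⌊a / (l : ℝ)⌋₊ : ℝ) = q at hq ⊢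
  have hq0 : 0 < q := by linarith
  have : (l : ℝ) / q * M ≤ l / 2 := by
    rw [div_mul_eq_mul_div, div_le_div_iff₀ hq0 two_pos]
    nlinarith
  linarith

/-- The ratio of the achievable rate to the cut-set expression at `ℓ = ⌊a / (2 * M)⌋₊` lies
between `0` and `4 + 2 / ℓ`. -/
lemma rate_div_cutset_mem_Icc {a M : ℝ} (hM : 0 < M)
    (hMint : ∃ j : ℕ, 0 < j ∧ 2 * M = (j : ℝ)) (hl : 0 < ⌊a / (2 * M)⌋₊) :
    (a / M - 1) / ((⌊a / (2 * M)⌋₊ : ℝ)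
      - ((⌊a / (2 * M)⌋₊ : ℝ) / (⌊a / (⌊a / (2 * M)⌋₊ : ℝ)⌋₊ : ℝ)) * M)
      ∈ Set.Icc 0 (4 + 2 / (⌊a / (2 * M)⌋₊ : ℝ)) := by
  have hD := half_floor_le_cutset hM hMint hl
  have hx : (⌊a / (2 * M)⌋₊ : ℝ) ≤ a / (2 * M) := Nat.floor_le (Nat.pos_of_floor_pos hl).le
  have hx' := Nat.lt_floor_add_one (a / (2 * M))
  have hl1 : (1 : ℝ) ≤ (⌊a / (2 * M)⌋₊ : ℝ) := by exact_mod_cast hl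
  have ha : a / M = 2 * (a / (2 * M)) := by field_simp
  rw [ha]
  generalize (⌊a / (2 * M)⌋₊ : ℝ) - _ = D at hD ⊢
  generalize (⌊a / (2 * M)⌋₊ : ℝ) = l at *
  have hD0 : 0 < D := by linarith
  refine ⟨div_nonneg (by linarith) hD0.le, ?_⟩
  rw [div_le_iff₀ hD0]
  calc 2 * (a / (2 * M)) - 1 ≤ (4 + 2 / l) * (l / 2) := by
        have : (4 + 2 / l) * (l / 2) = 2 * l + 1 := by field_simp; ring
        linarith
    _ ≤ (4 + 2 / l) * D := by gcongr

/-- Let `(m_k)` be positive integers with `m_k → ∞` and `(M_k)` positive reals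
with `2·M_k` a positive integer for every `k` and `M_k/m_k → 0`. Put `ℓ_k = ⌊m_k/(2·M_k)⌋`.
Then `limsup_k (m_k/M_k − 1)/(ℓ_k − (ℓ_k/⌊m_k/ℓ_k⌋)·M_k) ≤ 4`. -/
theorem stmt14 (m : ℕ → ℕ) (M : ℕ → ℝ)
    (hm : ∀ k, 0 < m k)
    (hm_top : Tendsto (fun k => (m k : ℝ)) atTop atTop)
    (hM : ∀ k, 0 < M k)
    (hMint : ∀ k, ∃ j : ℕ, 0 < j ∧ 2 * M k = (j : ℝ))
    (hratio : Tendsto (fun k => M k / (m k : ℝ)) atTop (nhds 0)) :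
    atTop.limsup (fun k =>
      ((m k : ℝ) / M k - 1) /
        ((⌊(m k : ℝ) / (2 * M k)⌋₊ : ℝ)
          - ((⌊(m k : ℝ) / (2 * M k)⌋₊ : ℝ)
              / (⌊(m k : ℝ) / (⌊(m k : ℝ) / (2 * M k)⌋₊ : ℝ)⌋₊ : ℝ)) * M k)) ≤ 4 := by
  have hl : Tendsto (fun k => ⌊(m k : ℝ) / (2 * M k)⌋₊) atTop atTop := by
    refine tendsto_nat_floor_atTop.comp ?_
    have hpos : Tendsto (fun k => M k / (m k : ℝ)) atTop (nhdsWithin 0 (Set.Ioi 0)) :=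
      tendsto_nhdsWithin_iff.2
        ⟨hratio, .of_forall fun k => div_pos (hM k) (Nat.cast_pos.2 (hm k))⟩
    refine (hpos.inv_tendsto_nhdsGT_zero.atTop_div_const two_pos).congr fun k => ?_
    rw [Pi.inv_apply, inv_div, div_div, mul_comm]
  have hv : Tendsto (fun k => 4 + 2 / (⌊(m k : ℝ) / (2 * M k)⌋₊ : ℝ)) atTop (nhds 4) := by
    simpa using ((tendsto_natCast_atTop_atTop.comp hl).const_div_atTop (2 : ℝ)).const_add 4
  have hmem := (hl.eventually_gt_atTop 0).mono fun k hk =>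
    rate_div_cutset_mem_Icc (hM k) (hMint k) hk
  rw [← hv.limsup_eq]
  exact limsup_le_limsup (hmem.mono fun _ h => h.2)
    (isBoundedUnder_of_eventually_ge (hmem.mono fun _ h => h.1)).isCoboundedUnder_le
    hv.isBoundedUnder_le
end

section
/- Let (m_k) be a sequence of positive integers with m_k → ∞, and let (M_k) be positive reals with 0 < M_k < m_k and M_k/m_k → c for some constant c ∈ (0, 1]. Define L_k = max_{ℓ ∈ {1, …, m_k}} ( ℓ − (ℓ/⌊m_k/ℓ⌋)·M_k ). Then limsup_{k→∞} (m_k/M_k − 1) / L_k ≤ 6. -/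
open Filter

/-- If `c ∈ (0, 1)`, the integer nearest to `1 / (2c)` makes the quadratic `ℓ - ℓ² c` at least
a sixth of `1 / c - 1`. -/
theorem exists_nat_inv_sub_one_lt (c : ℝ) (h0 : 0 < c) (h1 : c < 1) :
    ∃ l : ℕ, 0 < l ∧ c⁻¹ - 1 < 6 * ((l : ℝ) - l * (c * l)) := by
  obtain ⟨x, hx⟩ : ∃ x, x = c⁻¹ := ⟨_, rfl⟩
  have hx1 : 1 < x := hx ▸ (one_lt_inv₀ h0).2 h1
  have hcx : c * x = 1 := by rw [hx]; exact mul_inv_cancel₀ h0.ne'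
  refine ⟨⌊(x + 1) / 2⌋₊, Nat.floor_pos.2 (by linarith), ?_⟩
  have hle : ((⌊(x + 1) / 2⌋₊ : ℕ) : ℝ) ≤ (x + 1) / 2 := Nat.floor_le (by linarith)
  have hlt := Nat.lt_floor_add_one ((x + 1) / 2)
  rw [← hx]
  generalize ((⌊(x + 1) / 2⌋₊ : ℕ) : ℝ) = l at hle hlt ⊢
  have key : x * (x - 1) < 6 * (l * (x - l)) := by
    nlinarith [mul_nonneg (sub_nonneg.2 hle) (sub_nonneg.2 hlt.le),
      mul_pos (sub_pos.2 hx1) (sub_pos.2 hx1)]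
  have h := mul_lt_mul_of_pos_left key h0
  have e1 : c * (x * (x - 1)) = x - 1 := by linear_combination (x - 1) * hcx
  have e2 : c * (6 * (l * (x - l))) = 6 * (l - l * (c * l)) := by linear_combination 6 * l * hcx
  rwa [e1, e2] at h

/-- If `M k / m k → c` and `m k → ∞`, then `(l / ⌊m k / l⌋) * M k → l² c`. -/
theorem tendsto_div_floor_mul (m M : ℕ → ℝ) (c : ℝ) (l : ℕ) (hl : 0 < l)
    (hm_top : Tendsto m atTop atTop)
    (hratio : Tendsto (fun k => M k / m k) atTop (nhds c)) :
    Tendsto (fun k => (l : ℝ) / (⌊m k / (l : ℝ)⌋₊ : ℝ) * M k) atTop (nhds (l * (c * l))) := by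
  have hl' : (0 : ℝ) < l := Nat.cast_pos.2 hl
  have hfloor : Tendsto (fun k => (⌊(l : ℝ)⁻¹ * m k⌋₊ : ℝ) / m k) atTop (nhds (l : ℝ)⁻¹) :=
    (tendsto_nat_floor_mul_div_atTop (inv_nonneg.2 hl'.le)).comp hm_top
  have h := (hratio.div hfloor (inv_ne_zero hl'.ne')).const_mul (l : ℝ)
  rw [div_inv_eq_mul] at h
  refine h.congr' ?_
  filter_upwards [hm_top.eventually_gt_atTop 0] with k hk
  rw [Pi.div_apply, div_div_div_cancel_right₀ hk.ne', inv_mul_eq_div]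
  ring

/-- Let `(m_k)` be positive integers with `m_k → ∞` and `(M_k)` positive reals
with `0 < M_k < m_k` and `M_k/m_k → c` for some `c ∈ (0,1]`. Define
`L_k = max_{ℓ ∈ {1,…,m_k}} (ℓ − (ℓ/⌊m_k/ℓ⌋)·M_k)`. Then
`limsup_k (m_k/M_k − 1)/L_k ≤ 6`. -/
theorem stmt15 (m : ℕ → ℕ) (M : ℕ → ℝ) (c : ℝ)
    (hm : ∀ k, 0 < m k)
    (hm_top : Tendsto (fun k => (m k : ℝ)) atTop atTop)
    (hM : ∀ k, 0 < M k) (hMm : ∀ k, M k < (m k : ℝ))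
    (hc : c ∈ Set.Ioc (0 : ℝ) 1)
    (hratio : Tendsto (fun k => M k / (m k : ℝ)) atTop (nhds c)) :
    atTop.limsup (fun k =>
      ((m k : ℝ) / M k - 1) /
        ((Finset.Icc 1 (m k)).sup' (Finset.nonempty_Icc.mpr (hm k))
          (fun ℓ => (ℓ : ℝ) - ((ℓ : ℝ) / (⌊(m k : ℝ) / (ℓ : ℝ)⌋₊ : ℝ)) * M k))) ≤ 6 := by
  have hm' : ∀ k, (0 : ℝ) < m k := fun k => Nat.cast_pos.2 (hm k)
  set L : ℕ → ℝ := fun k => (Finset.Icc 1 (m k)).sup' (Finset.nonempty_Icc.mpr (hm k))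
    (fun ℓ => (ℓ : ℝ) - ((ℓ : ℝ) / (⌊(m k : ℝ) / (ℓ : ℝ)⌋₊ : ℝ)) * M k)
  have le_L : ∀ k l, 0 < l → l ≤ m k →
      (l : ℝ) - ((l : ℝ) / (⌊(m k : ℝ) / (l : ℝ)⌋₊ : ℝ)) * M k ≤ L k := fun k l h1 h2 =>
    Finset.le_sup' (fun ℓ : ℕ => (ℓ : ℝ) - ((ℓ : ℝ) / (⌊(m k : ℝ) / (ℓ : ℝ)⌋₊ : ℝ)) * M k)
      (Finset.mem_Icc.2 ⟨h1, h2⟩)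
  have one_sub_le_L : ∀ k, 1 - M k / m k ≤ L k := fun k => by
    have h := le_L k 1 one_pos (hm k)
    rwa [Nat.cast_one, div_one, Nat.floor_natCast, one_div_mul_eq_div] at h
  have L_pos : ∀ k, 0 < L k := fun k =>
    (sub_pos.2 ((div_lt_one (hm' k)).2 (hMm k))).trans_le (one_sub_le_L k)
  have rate_nonneg : ∀ k, 0 ≤ (m k : ℝ) / M k - 1 := fun k =>
    sub_nonneg.2 ((one_le_div (hM k)).2 (hMm k).le)
  change atTop.limsup (fun k => ((m k : ℝ) / M k - 1) / L k) ≤ 6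
  refine limsup_le_of_le (IsBoundedUnder.isCoboundedUnder_le
    (isBoundedUnder_of ⟨0, fun k => div_nonneg (rate_nonneg k) (L_pos k).le⟩)) ?_
  have hinv : Tendsto (fun k => (m k : ℝ) / M k) atTop (nhds c⁻¹) := by
    simpa only [inv_div] using hratio.inv₀ hc.1.ne'
  rcases hc.2.lt_or_eq with hc1 | rfl
  · obtain ⟨l, hl, hlc⟩ := exists_nat_inv_sub_one_lt c hc.1 hc1
    have hlim := ((tendsto_div_floor_mul _ M c l hl hm_top hratio).const_sub (l : ℝ)).const_mul 6
    filter_upwards [(hinv.sub_const 1).eventually_lt hlim hlc,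
      hm_top.eventually_ge_atTop (l : ℝ)] with k hk hlk
    rw [div_le_iff₀ (L_pos k)]
    exact hk.le.trans (mul_le_mul_of_nonneg_left (le_L k l hl (Nat.cast_le.1 hlk)) (by norm_num))
  · filter_upwards [hinv.eventually_lt_const (show (1 : ℝ)⁻¹ < 6 by norm_num)] with k hk
    rw [div_le_iff₀ (L_pos k)]
    calc (m k : ℝ) / M k - 1 = (m k : ℝ) / M k * (1 - M k / m k) := by
          rw [mul_sub, mul_one, div_mul_div_cancel₀ (hM k).ne', div_self (hm' k).ne']
      _ ≤ 6 * L k := mul_le_mul hk.le (one_sub_le_L k)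
          (sub_nonneg.2 ((div_le_one (hm' k)).2 (hMm k).le)) (by norm_num)
end

section
/- Fix ε ∈ (0,1) and η > 0. For t > 1 let ρ*(t) be the unique solution in (0,1) of x = 1 − exp(−t·x), and set ρ(t) = (1−ε)·ρ*(t) and f_{ρ(t)}(t) = 3/(ρ(t)·t) − exp(−ρ(t)·t)·( 3/(ρ(t)·t) + 4 + (5/2)·ρ(t)·t ). Then there exists a finite constant C (depending only on ε and η) such that for all t ≥ 1 + η: (1/ρ(t)²)·(1 + f_{ρ(t)}(t)) ≤ C. -/
/-- A positive solution of `x = 1 - exp (-t * x)` is at least `1 - 1 / t`. -/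
theorem sub_one_le_mul_of_eq_one_sub_exp {t x : ℝ} (ht : 0 < t) (hx : 0 < x)
    (h : x = 1 - Real.exp (-t * x)) : t - 1 ≤ t * x := by
  have hy : 0 < t * x := mul_pos ht hx
  have hexp : Real.exp (-t * x) * (t * x + 1) ≤ 1 := by
    calc Real.exp (-t * x) * (t * x + 1)
        ≤ Real.exp (-t * x) * Real.exp (t * x) := by
          gcongr
          exact Real.add_one_le_exp _
      _ = 1 := by rw [← Real.exp_add]; simp
  have hE : Real.exp (-t * x) = 1 - x := by linarith
  rw [hE] at hexp
  have hmul : 0 ≤ x * (t * x + 1 - t) := by linarith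
  linarith [nonneg_of_mul_nonneg_right hmul hx]

/-- Fix `ε ∈ (0,1)` and `η > 0`. For `t > 1` let `ρ*(t)` be the unique
solution in `(0,1)` of `x = 1 − exp(−t·x)` and set `ρ(t) = (1−ε)·ρ*(t)` and
`f_{ρ(t)}(t) = 3/(ρ(t)·t) − exp(−ρ(t)·t)·(3/(ρ(t)·t) + 4 + (5/2)·ρ(t)·t)`. Then there is a
finite constant `C` such that `(1/ρ(t)²)·(1 + f_{ρ(t)}(t)) ≤ C` for all `t ≥ 1 + η`. -/
theorem stmt16 (ε η : ℝ) (hε : ε ∈ Set.Ioo (0 : ℝ) 1) (hη : 0 < η)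
    (ρstar : ℝ → ℝ)
    (hρstar : ∀ t : ℝ, 1 < t →
      ρstar t ∈ Set.Ioo (0 : ℝ) 1 ∧ ρstar t = 1 - Real.exp (-t * ρstar t)) :
    ∃ C : ℝ, ∀ t : ℝ, 1 + η ≤ t →
      (1 / ((1 - ε) * ρstar t) ^ 2) *
          (1 + (3 / (((1 - ε) * ρstar t) * t)
            - Real.exp (-(((1 - ε) * ρstar t) * t)) *
                (3 / (((1 - ε) * ρstar t) * t) + 4 + (5 / 2) * (((1 - ε) * ρstar t) * t))))
        ≤ C := by
  obtain ⟨hε0, hε1⟩ := hε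
  have hc : 0 < (1 - ε) * (η / (1 + η)) := mul_pos (by linarith) (by positivity)
  set c := (1 - ε) * (η / (1 + η)) with hc_def
  refine ⟨1 / c ^ 2 * (1 + 3 / c), fun t ht => ?_⟩
  obtain ⟨⟨hx0, hx1⟩, hfix⟩ := hρstar t (by linarith)
  have hbound := sub_one_le_mul_of_eq_one_sub_exp (by linarith) hx0 hfix
  have hstar : η / (1 + η) ≤ ρstar t := by
    rw [div_le_iff₀ (by positivity)]
    nlinarith
  have hρ : c ≤ (1 - ε) * ρstar t := mul_le_mul_of_nonneg_left hstar (by linarith)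
  set r := (1 - ε) * ρstar t
  have hr : 0 < r := hc.trans_le hρ
  have hrt : c ≤ r * t := hρ.trans (le_mul_of_one_le_right hr.le (by linarith))
  have hrt0 : 0 < r * t := hc.trans_le hrt
  have hdrop : 0 ≤ Real.exp (-(r * t)) * (3 / (r * t) + 4 + (5 / 2) * (r * t)) := by
    positivity
  calc 1 / r ^ 2 * (1 + (3 / (r * t)
          - Real.exp (-(r * t)) * (3 / (r * t) + 4 + (5 / 2) * (r * t))))
      ≤ 1 / r ^ 2 * (1 + 3 / (r * t)) := by
        apply mul_le_mul_of_nonneg_left _ (by positivity)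
        linarith
    _ ≤ 1 / c ^ 2 * (1 + 3 / c) := by gcongr
end
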